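/- arXiv:2002.08814 — 3 statements merged into one kernel-verified Lean document; each statement's English description precedes it below -/
import Mathlib

section
/- Let d ≥ 4 be an even integer. Then for any prime p with p ≡ -1 (mod d), the rational number ∑_{k=0}^{p-1} (1/d)_k^d / (k!)^d is congruent to 0 modulo p^3, i.e., its p-adic valuation is at least 3. -/
open Finset Polynomial

/-- The alternating binomial sum of length `n + 1` kills polynomials of degree less than `n`. -/
theorem sum_neg_one_pow_mul_choose_mul_eval_eq_zero {R : Type*} [CommRing R] (f : R[X]) {n : ℕ}
    (hf : f.natDegree < n) :
    ∑ k ∈ range (n + 1), (-1 : R) ^ k * (n.choose k : R) * f.eval (k : R) = 0 := by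
  have h := congrFun (Polynomial.fwdDiff_iter_eq_zero_of_degree_lt hf) 0
  rw [fwdDiff_iter_eq_sum_shift] at h
  have h2 : (-1 : R) ^ n * ∑ k ∈ range (n + 1), ((-1 : ℤ) ^ (n - k) * n.choose k) •
      f.eval (0 + k • 1) = 0 := by
    rw [h]; simp
  rw [← h2, mul_sum]
  refine sum_congr rfl fun k hk => ?_
  obtain ⟨r, rfl⟩ := Nat.exists_eq_add_of_le (Nat.lt_succ_iff.mp (mem_range.mp hk))
  have : (-1 : R) ^ r * (-1) ^ r = 1 := by rw [← mul_pow]; simp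
  simp only [zsmul_eq_mul, nsmul_eq_mul, mul_one, zero_add, Nat.add_sub_cancel_left, pow_add]
  push_cast
  linear_combination (-(-1 : R) ^ k * ((k + r).choose k : R) * f.eval (k : R)) * this

theorem ZMod.neg_one_pow_mul_choose_pred {p : ℕ} [hp : Fact p.Prime] {k : ℕ} (hk : k < p) :
    (-1 : ZMod p) ^ k * ((p - 1).choose k : ZMod p) = 1 := by
  induction k with
  | zero => simp
  | succ k ih =>
    have h := Nat.choose_succ_succ (p - 1) k
    rw [Nat.succ_eq_add_one, Nat.sub_add_cancel hp.out.one_le] at h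
    have h0 : ((p.choose (k + 1) : ℕ) : ZMod p) = 0 :=
      (ZMod.natCast_eq_zero_iff _ _).2 (hp.out.dvd_choose_self k.succ_ne_zero hk)
    rw [h] at h0
    push_cast at h0
    have := ih (by omega)
    rw [pow_succ]
    linear_combination this - (-1 : ZMod p) ^ k * h0

theorem ZMod.sum_eval_natCast_eq_zero {p : ℕ} [hp : Fact p.Prime] (f : (ZMod p)[X])
    (hf : f.natDegree < p - 1) : ∑ k ∈ range p, f.eval (k : ZMod p) = 0 := by
  have h := sum_neg_one_pow_mul_choose_mul_eval_eq_zero f hf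
  rw [Nat.sub_add_cancel hp.out.one_le] at h
  rw [← h]
  refine sum_congr rfl fun k hk => ?_
  rw [ZMod.neg_one_pow_mul_choose_pred (mem_range.mp hk), one_mul]

theorem natDegree_prod_X_add_C_le {R ι : Type*} [CommRing R] (s : Finset ι) (g : ι → R) :
    (∏ i ∈ s, (X + C (g i))).natDegree ≤ #s := by
  refine (natDegree_prod_le _ _).trans ?_
  rw [← mul_one #s]
  exact sum_le_card_nsmul s _ 1 fun i _ =>
    (natDegree_add_C.trans_le natDegree_X_le : (X + C (g i)).natDegree ≤ 1)

theorem dvd_one_add_pow_sub {R : Type*} [CommRing R] (z : R) (n : ℕ) :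
    z ^ 3 ∣ (1 + z) ^ n - (1 + n * z + n.choose 2 * z ^ 2) := by
  induction n with
  | zero => simp
  | succ n ih =>
    obtain ⟨t, ht⟩ := ih
    refine ⟨(1 + z) * t + n.choose 2, ?_⟩
    rw [Nat.choose_succ_succ' n 1, Nat.choose_one_right, pow_succ]
    push_cast
    linear_combination (1 + z) * ht

/-- Reflection of the harmonic numbers of order two modulo `p`. -/
theorem ZMod.sum_inv_sq_reflect {p : ℕ} [hp : Fact p.Prime] {k : ℕ} (hk : k < p) :
    ∑ j ∈ range (p - 1 - k), ((j : ZMod p) + 1)⁻¹ ^ 2 =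
      ∑ j ∈ range (p - 1), ((j : ZMod p) + 1)⁻¹ ^ 2 - ∑ j ∈ range k, ((j : ZMod p) + 1)⁻¹ ^ 2 := by
  induction k with
  | zero => simp
  | succ k ih =>
    have h := ih (by omega)
    obtain ⟨r, hr⟩ : ∃ r, p = r + k + 2 := ⟨p - k - 2, by omega⟩
    have e1 : p - 1 - k = r + 1 := by omega
    have e2 : p - 1 - (k + 1) = r := by omega
    have h3 : ((r : ZMod p) + 1) = -(k + 1) := by
      have := congrArg (Nat.cast (R := ZMod p)) hr
      push_cast at this
      rw [ZMod.natCast_self] at this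
      linear_combination -this
    rw [e1, sum_range_succ, h3, inv_neg, neg_sq] at h
    rw [e2, sum_range_succ]
    linear_combination h

theorem ZMod.sum_prod_pow_eq_zero {p : ℕ} [hp : Fact p.Prime] {d n : ℕ} (hd : 4 ≤ d)
    (hpd : p + 1 = d * (n + 1)) :
    ∑ k ∈ range p, (∏ i ∈ range n, ((k : ZMod p) + (i + 1))) ^ d = 0 := by
  have hdeg : ((∏ i ∈ range n, (X + C ((i : ZMod p) + 1))) ^ d).natDegree < p - 1 := by
    refine (natDegree_pow_le_of_le d (natDegree_prod_X_add_C_le _ _)).trans_lt ?_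
    rw [card_range]
    rw [mul_add_one] at hpd
    omega
  have h := ZMod.sum_eval_natCast_eq_zero _ hdeg
  simpa [eval_prod] using h

theorem ZMod.sum_prod_pow_mul_inv_sq_eq_zero {p : ℕ} [hp : Fact p.Prime] {d n : ℕ} (hd : 4 ≤ d)
    (hpd : p + 1 = d * (n + 1)) {j : ℕ} (hj : j ∈ range n) :
    ∑ k ∈ range p, (∏ i ∈ range n, ((k : ZMod p) + (i + 1))) ^ d *
      ((k : ZMod p) + (j + 1))⁻¹ ^ 2 = 0 := by
  let g : ℕ → (ZMod p)[X] := fun i => X + C ((i : ZMod p) + 1)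
  have hdeg : ((∏ i ∈ (range n).erase j, g i) ^ d * g j ^ (d - 2)).natDegree < p - 1 := by
    have h1 := natDegree_pow_le_of_le d
      (natDegree_prod_X_add_C_le ((range n).erase j) fun i => (i : ZMod p) + 1)
    have h2 : (g j ^ (d - 2)).natDegree ≤ (d - 2) * 1 :=
      natDegree_pow_le_of_le _ (natDegree_add_C.trans_le natDegree_X_le)
    refine (natDegree_mul_le_of_le h1 h2).trans_lt ?_
    rw [card_erase_of_mem hj, card_range]
    obtain ⟨r, rfl⟩ : ∃ r, n = r + 1 := ⟨n - 1, by have := mem_range.mp hj; omega⟩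
    simp only [mul_add_one, Nat.add_sub_cancel] at hpd ⊢
    omega
  rw [← ZMod.sum_eval_natCast_eq_zero _ hdeg]
  refine sum_congr rfl fun k _ => ?_
  rw [← mul_prod_erase _ _ hj]
  simp only [g, eval_mul, eval_pow, eval_prod, eval_add, eval_X, eval_C]
  obtain ⟨c, rfl⟩ : ∃ c, d = c + 3 := ⟨d - 3, by omega⟩
  rw [show c + 3 - 2 = c + 1 by omega]
  generalize (k : ZMod p) + (j + 1) = y
  by_cases hy : y = 0
  · simp [hy]
  · field_simp
    ring

theorem ZMod.sum_prod_pow_mul_sum_inv_sq_eq_zero {p : ℕ} [hp : Fact p.Prime] {d n : ℕ}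
    (hd : 4 ≤ d) (hde : Even d) (hpd : p + 1 = d * (n + 1)) :
    ∑ k ∈ range p, (∏ i ∈ range n, ((k : ZMod p) + (i + 1))) ^ d *
      ∑ j ∈ range k, ((j : ZMod p) + 1)⁻¹ ^ 2 = 0 := by
  have hlt : n + 2 < p := by
    have : 4 * (n + 1) ≤ d * (n + 1) := Nat.mul_le_mul_right _ hd
    omega
  obtain ⟨N, hN⟩ : ∃ N, p = N + 1 + n := ⟨p - 1 - n, by omega⟩
  have hN0 : (N : ZMod p) = -(n + 1) := by
    have := congrArg (Nat.cast (R := ZMod p)) hN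
    push_cast at this
    rw [ZMod.natCast_self] at this
    linear_combination -this
  set F : ℕ → ZMod p := fun k => (∏ i ∈ range n, ((k : ZMod p) + (i + 1))) ^ d with hF
  set H : ℕ → ZMod p := fun k => ∑ j ∈ range k, ((j : ZMod p) + 1)⁻¹ ^ 2 with hH
  change ∑ k ∈ range p, F k * H k = 0
  have hrestrict (g : ℕ → ZMod p) :
      ∑ k ∈ range p, F k * g k = ∑ k ∈ range (N + 1), F k * g k := by
    refine (sum_subset (range_subset_range.2 (by omega)) fun k hk hk' => ?_).symm
    rw [mem_range] at hk hk'
    have hz : (k : ZMod p) + ((p - 1 - k : ℕ) + 1) = 0 := by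
      rw [← Nat.cast_add_one, ← Nat.cast_add, show k + (p - 1 - k + 1) = p by omega,
        ZMod.natCast_self]
    have : F k = 0 := by
      simp only [hF]
      rw [prod_eq_zero (mem_range.2 (by omega : p - 1 - k < n)) hz, zero_pow (by omega)]
    rw [this, zero_mul]
  have hreflect {k : ℕ} (hk : k ≤ N) : F (N - k) = F k := by
    have : ∏ i ∈ range n, (((N - k : ℕ) : ZMod p) + (i + 1)) =
        (-1) ^ n * ∏ i ∈ range n, ((k : ZMod p) + (i + 1)) := by
      rw [← prod_range_reflect, ← card_range n, ← prod_const, card_range, ← prod_mul_distrib]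
      refine prod_congr rfl fun i hi => ?_
      obtain ⟨r, rfl⟩ : ∃ r, n = r + i + 1 := ⟨n - i - 1, by have := mem_range.mp hi; omega⟩
      rw [show r + i + 1 - 1 - i = r by omega, Nat.cast_sub hk, hN0]
      push_cast
      ring
    simp only [hF, this, mul_pow]
    rw [← pow_mul, (hde.mul_left n).neg_one_pow, one_mul]
  have hsum : ∑ k ∈ range p, F k * H k =
      ∑ k ∈ range (N + 1), F k * (H (p - 1) - H (k + n)) := by
    rw [hrestrict, ← sum_range_reflect]
    refine sum_congr rfl fun k hk => ?_
    have hk := mem_range.mp hk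
    rw [show N + 1 - 1 - k = N - k by omega, hreflect (by omega),
      show N - k = p - 1 - (k + n) by omega]
    simp only [hH]
    rw [ZMod.sum_inv_sq_reflect (by omega)]
  have htwice : 2 * ∑ k ∈ range p, F k * H k = H (p - 1) * ∑ k ∈ range p, F k -
      ∑ j ∈ range n, ∑ k ∈ range p, F k * ((k : ZMod p) + (j + 1))⁻¹ ^ 2 := by
    rw [two_mul]
    nth_rw 2 [hsum]
    rw [hrestrict, ← sum_add_distrib, sum_comm, mul_sum, ← sum_sub_distrib]
    simp only [← mul_sum, mul_comm (H (p - 1)), ← mul_sub]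
    rw [hrestrict]
    refine sum_congr rfl fun k _ => ?_
    have : H (k + n) = H k + ∑ i ∈ range n, ((k : ZMod p) + (i + 1))⁻¹ ^ 2 := by
      simp only [hH, sum_range_add, Nat.cast_add, add_assoc]
    rw [this]
    ring
  rw [ZMod.sum_prod_pow_eq_zero hd hpd,
    sum_eq_zero fun j hj => ZMod.sum_prod_pow_mul_inv_sq_eq_zero hd hpd hj] at htwice
  have h2 : (2 : ZMod p) ≠ 0 := by
    have : ((2 : ℕ) : ZMod p) ≠ 0 := by
      rw [Ne, ZMod.natCast_eq_zero_iff]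
      exact fun h => absurd (Nat.le_of_dvd two_pos h) (by omega)
    exact_mod_cast this
  simpa [h2] using htwice

section Coefficients

variable {R : Type*} [CommRing R] {p : ℕ} {u : ℕ → R}

/-- With `u j` the inverse of `j + 1`, this says that `(n + 1 + x)_k / k! * (1 + x)_n` equals
`(1 + x)_k / k! * (k + 1 + x)_n`. -/
theorem prod_mul_prod_eq_prod_mul_prod (hu : ∀ j < p - 1, ((j : R) + 1) * u j = 1) (n : ℕ) (x : R)
    {k : ℕ} (hk : k < p) :
    (∏ j ∈ range k, (n + 1 + x + j) * u j) * ∏ i ∈ range n, (x + (i + 1)) =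
      (∏ j ∈ range k, (1 + x * u j)) * ∏ i ∈ range n, (k + x + (i + 1)) := by
  induction k with
  | zero => simp
  | succ k ih =>
    have h := ih (by omega)
    have hshift : (∏ i ∈ range n, ((k : R) + x + (i + 1))) * (k + x + (n + 1)) =
        (∏ i ∈ range n, (((k + 1 : ℕ) : R) + x + (i + 1))) * (k + x + 1) := by
      have := (prod_range_succ (fun i : ℕ => (k : R) + x + (i + 1)) n).symm.trans
        (prod_range_succ' (fun i : ℕ => (k : R) + x + (i + 1)) n)
      push_cast at this ⊢
      rw [this, zero_add]
      congr 1
      exact prod_congr rfl fun i _ => by ring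
    rw [prod_range_succ, prod_range_succ]
    linear_combination (n + 1 + x + k) * u k * h +
      (∏ j ∈ range k, (1 + x * u j)) * u k * hshift +
      (∏ j ∈ range k, (1 + x * u j)) * (∏ i ∈ range n, (((k + 1 : ℕ) : R) + x + (i + 1))) *
        hu k (by omega)

theorem prod_one_sub_mul_eq (hu : ∀ j < p - 1, ((j : R) + 1) * u j = 1) {k : ℕ} (hk : k < p) :
    ∏ j ∈ range k, (1 - p * u j) = (-1) ^ k * ((p - 1).choose k : R) := by
  induction k with
  | zero => simp
  | succ k ih =>
    have h := congrArg (Nat.cast (R := R)) (Nat.choose_succ_right_eq (p - 1) k)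
    obtain ⟨r, rfl⟩ : ∃ r, p = r + k + 2 := ⟨p - k - 2, by omega⟩
    rw [show r + k + 2 - 1 - k = r + 1 by omega] at h
    rw [prod_range_succ, ih (by omega)]
    rw [show r + k + 2 - 1 = r + k + 1 by omega] at h ⊢
    push_cast at h ⊢
    rw [pow_succ]
    linear_combination (-1 : R) ^ k * u k * h - (-1 : R) ^ k *
      ((r + k + 1).choose k + (r + k + 1).choose (k + 1)) * hu k (by omega)

theorem pow_three_dvd_prod_pow_sub {d : ℕ} {e q : R} (he : d * e = 1) (k : ℕ) :
    q ^ 3 ∣ (∏ j ∈ range k, (1 + -(q * e) * u j)) ^ d -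
      (∏ j ∈ range k, (1 - q * u j)) *
        (1 + e ^ 2 * d.choose 2 * q ^ 2 * ∑ j ∈ range k, u j ^ 2) := by
  induction k with
  | zero => simp
  | succ k ih =>
    obtain ⟨t, ht⟩ := ih
    obtain ⟨s, hs⟩ := dvd_one_add_pow_sub (-(q * e) * u k) d
    rw [prod_range_succ, prod_range_succ, sum_range_succ, mul_pow]
    generalize (∏ j ∈ range k, (1 + -(q * e) * u j)) ^ d = A at *
    generalize (∏ j ∈ range k, (1 - q * u j)) = B at *
    generalize (∑ j ∈ range k, u j ^ 2) = H at *
    generalize (1 + -(q * e) * u k) ^ d = Z at *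
    generalize (d.choose 2 : R) = D at *
    refine ⟨t * Z + B * (1 + e ^ 2 * D * q ^ 2 * H) * (-(e * u k) ^ 3 * s) +
      B * (e ^ 2 * D) * (e ^ 2 * D * q * H * u k ^ 2 + u k ^ 3), ?_⟩
    linear_combination Z * ht + B * (1 + e ^ 2 * D * q ^ 2 * H) * (hs - q * u k * he)

/-- The supercongruence in a ring `R` in which `1, …, p - 1` and `d` are invertible and whose
reduction modulo `p` is `ZMod p`. -/
theorem pow_three_dvd_sum_prod_pow [hp : Fact p.Prime] (φ : R →+* ZMod p)
    (hφ : ∀ r, φ r = 0 → (p : R) ∣ r) (hu : ∀ j < p - 1, ((j : R) + 1) * u j = 1)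
    {d : ℕ} (hd : 4 ≤ d) (hde : Even d) (hpd : d ∣ p + 1) {e : R} (he : d * e = 1) :
    (p : R) ^ 3 ∣ ∑ k ∈ range p, (∏ j ∈ range k, (e + j) * u j) ^ d := by
  obtain ⟨n, hn⟩ : ∃ n, p + 1 = d * (n + 1) := by
    obtain ⟨m, hm⟩ := hpd
    obtain _ | n := m
    · simp at hm
    · exact ⟨n, hm⟩
  have hnp : n < p := by
    have : 4 * (n + 1) ≤ d * (n + 1) := Nat.mul_le_mul_right _ hd
    omega
  set x : R := -(p * e) with hx
  have hex : e = n + 1 + x := by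
    have := congrArg (Nat.cast (R := R)) hn
    push_cast at this
    linear_combination e * this + (n + 1) * he
  set P : ℕ → R := fun k => ∏ i ∈ range n, (k + x + (i + 1)) with hP
  set H : ℕ → R := fun k => ∑ j ∈ range k, u j ^ 2 with hH
  set V : ℕ → R := fun k => ∏ j ∈ range k, (1 - p * u j) with hV
  set c : R := e ^ 2 * d.choose 2
  have hcop : IsCoprime ((p : R) ^ 3) ((∏ i ∈ range n, (x + (i + 1))) ^ d) := by
    refine IsCoprime.pow (IsCoprime.prod_right fun i hi => ?_)
    have hi := mem_range.mp hi
    have h : IsCoprime (p : R) ((i + 1 : ℕ) : R) := by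
      have := (Nat.isCoprime_iff_coprime.2
        ((Nat.coprime_of_lt_prime (by omega) (by omega : i + 1 < p) hp.out))).map
          (Int.castRingHom R)
      simpa using this
    rw [show x + ((i : R) + 1) = ((i + 1 : ℕ) : R) + p * (-e) by rw [hx]; push_cast; ring]
    exact h.add_mul_left_right (-e)
  refine hcop.dvd_of_dvd_mul_right ?_
  have hmain : ∑ k ∈ range p, V k * P k ^ d = 0 := by
    have hdeg : ((∏ i ∈ range n, (X + C (x + ((i : R) + 1)))) ^ d).natDegree < p - 1 := by
      refine (natDegree_pow_le_of_le d (natDegree_prod_X_add_C_le _ _)).trans_lt ?_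
      rw [card_range]
      rw [mul_add_one] at hn
      omega
    have h := sum_neg_one_pow_mul_choose_mul_eval_eq_zero _ hdeg
    rw [Nat.sub_add_cancel hp.out.one_le] at h
    rw [← h]
    refine sum_congr rfl fun k hk => ?_
    simp only [hV, hP]
    rw [prod_one_sub_mul_eq hu (mem_range.mp hk)]
    simp [eval_prod, add_assoc]
  have hcorr : (p : R) ∣ ∑ k ∈ range p, V k * P k ^ d * H k := by
    refine hφ _ ?_
    rw [← ZMod.sum_prod_pow_mul_sum_inv_sq_eq_zero hd hde hn, map_sum]
    refine sum_congr rfl fun k hk => ?_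
    have hk := mem_range.mp hk
    have hsum : φ (H k) = ∑ j ∈ range k, ((j : ZMod p) + 1)⁻¹ ^ 2 := by
      simp only [hH, map_sum, map_pow]
      refine sum_congr rfl fun j hj => ?_
      have := congrArg φ (hu j (by have := mem_range.mp hj; omega))
      rw [map_mul, map_add, map_natCast, map_one] at this
      rw [eq_inv_of_mul_eq_one_right this]
    rw [map_mul, hsum]
    simp [hV, hP, hx, map_prod]
  have hterm : ∀ k ∈ range p, (p : R) ^ 3 ∣
      (∏ j ∈ range k, (e + j) * u j) ^ d * (∏ i ∈ range n, (x + (i + 1))) ^ d -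
        V k * P k ^ d * (1 + c * p ^ 2 * H k) := by
    intro k hk
    rw [← mul_pow, hex, prod_mul_prod_eq_prod_mul_prod hu n x (mem_range.mp hk), mul_pow]
    obtain ⟨t, ht⟩ := pow_three_dvd_prod_pow_sub (u := u) (q := (p : R)) he k
    exact ⟨t * P k ^ d, by linear_combination P k ^ d * ht⟩
  have h := dvd_sum hterm
  rw [sum_sub_distrib, ← sum_mul] at h
  refine (dvd_sub_left ?_).1 h
  obtain ⟨t, ht⟩ := hcorr
  refine ⟨c * t, ?_⟩
  calc _ = ∑ k ∈ range p, V k * P k ^ d + c * p ^ 2 * ∑ k ∈ range p, V k * P k ^ d * H k := by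
        rw [mul_sum, ← sum_add_distrib]
        exact sum_congr rfl fun k _ => by ring
    _ = _ := by rw [hmain, ht]; ring

end Coefficients

theorem exists_eq_pow_mul_div_of_dvd {p : ℕ} [hp : Fact p.Prime] {n : ℕ} {r : ℚ} {z : ℤ_[p]}
    (hz : (z : ℚ_[p]) = r) (hdvd : (p : ℤ_[p]) ^ n ∣ z) :
    ∃ a b : ℤ, ¬ (p : ℤ) ∣ b ∧ r = (p : ℚ) ^ n * a / b := by
  obtain ⟨t, rfl⟩ := hdvd
  have hp0 : (p : ℚ) ≠ 0 := Nat.cast_ne_zero.2 hp.out.ne_zero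
  have hp0' : (p : ℚ_[p]) ≠ 0 := Nat.cast_ne_zero.2 hp.out.ne_zero
  have ht : ((r / p ^ n : ℚ) : ℚ_[p]) = t := by
    push_cast at hz ⊢
    rw [← hz]
    field_simp
  refine ⟨(r / p ^ n).num, (r / p ^ n).den, fun h => ?_, ?_⟩
  · have hu := PadicInt.isUnit_den (p := p) (r / p ^ n) (ht ▸ t.norm_le_one)
    rw [PadicInt.isUnit_iff] at hu
    have := (PadicInt.norm_int_lt_one_iff_dvd (p := p) ((r / p ^ n).den : ℤ)).2 h
    rw [Int.cast_natCast] at this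
    exact this.ne hu
  · rw [mul_div_assoc, Int.cast_natCast, Rat.num_div_den]
    field_simp


/-- Let `d ≥ 4` be an even integer. Then for any prime `p ≡ -1 (mod d)`,
the rational number `∑_{k=0}^{p-1} (1/d)_k^d / (k!)^d` is congruent to `0` modulo `p^3`,
i.e. it can be written as `p^3 * a / b` with `p ∤ b`. -/
theorem stmt_2 (d : ℕ) (hd : 4 ≤ d) (hde : Even d)
    (p : ℕ) (hp : p.Prime) (hpd : d ∣ p + 1) :
    ∃ a b : ℤ, ¬ ((p : ℤ) ∣ b) ∧
      ∑ k ∈ Finset.range p,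
          ((ascPochhammer ℚ k).eval ((1 : ℚ) / (d : ℚ))) ^ d / ((k.factorial : ℚ)) ^ d
        = (p : ℚ) ^ 3 * a / b := by
  have : Fact p.Prime := ⟨hp⟩
  have hunit {j : ℕ} (hj : ¬ p ∣ j) : (j : ℤ_[p]) * Ring.inverse (j : ℤ_[p]) = 1 := by
    refine Ring.mul_inverse_cancel _ ?_
    rw [PadicInt.isUnit_iff]
    refine le_antisymm (PadicInt.norm_le_one _) (not_lt.1 fun h => hj ?_)
    have := (PadicInt.norm_int_lt_one_iff_dvd (p := p) (j : ℤ)).1 (by simpa using h)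
    exact_mod_cast this
  have hcast {j : ℕ} (hj : ¬ p ∣ j) :
      ((Ring.inverse (j : ℤ_[p]) : ℤ_[p]) : ℚ_[p]) = (j : ℚ_[p])⁻¹ := by
    have := congrArg ((↑) : ℤ_[p] → ℚ_[p]) (hunit hj)
    push_cast at this
    exact eq_inv_of_mul_eq_one_right this
  have hd' : ¬ p ∣ d := fun h => by
    have := (Nat.dvd_add_right (dvd_refl p)).1 (h.trans hpd)
    exact hp.one_lt.ne' (Nat.dvd_one.1 this)
  have hsucc {j : ℕ} (hj : j + 1 < p) : ¬ p ∣ j + 1 := Nat.not_dvd_of_pos_of_lt j.succ_pos hj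
  refine exists_eq_pow_mul_div_of_dvd ?_ (pow_three_dvd_sum_prod_pow PadicInt.toZMod
    (fun r hr => ?_) (u := fun j => Ring.inverse ((j + 1 : ℕ) : ℤ_[p])) (fun j hj => ?_)
    hd hde hpd (hunit hd'))
  · rw [PadicInt.coe_sum, Rat.cast_sum]
    refine sum_congr rfl fun k hk => ?_
    rw [← div_pow, PadicInt.coe_pow, Rat.cast_pow]
    congr 1
    have hk := mem_range.mp hk
    clear * - hk hcast hsucc hd'
    induction k with
    | zero => simp
    | succ k ih =>
      rw [prod_range_succ, PadicInt.coe_mul, ih (by omega), ascPochhammer_succ_eval,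
        Nat.factorial_succ, PadicInt.coe_mul, PadicInt.coe_add, hcast (hsucc hk), hcast hd']
      push_cast
      field_simp
  · rwa [← RingHom.mem_ker, PadicInt.ker_toZMod, PadicInt.maximalIdeal_eq_span_p,
      Ideal.mem_span_singleton] at hr
  · have := hunit (hsucc (by omega : j + 1 < p))
    push_cast at this ⊢
    exact this
end

section
/- Let n > 2 and q > 0 be integers such that n is even or q is odd, and let p be a prime with p > max{n, (q-1)n + 1}. Then the rational number ∑_{k=0}^{p-q} ((q)_k^n / (1)_k^n) · H_k^{(2)} is congruent to 0 modulo p, i.e., its p-adic valuation is at least 1. -/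
/-- `H m k` is the `k`-th harmonic number of order `m`: `H_k^{(m)} = ∑_{j=1}^k 1/j^m`. -/
def harm (m k : ℕ) : ℚ := ∑ j ∈ Finset.range k, 1 / ((j : ℚ) + 1) ^ m

/-- A rational number `x` with denominator prime to `p` reduces to `z` modulo `p`. -/
def ReducesTo (p : ℕ) [Fact p.Prime] (x : ℚ) (z : ZMod p) : Prop :=
  ∃ a b : ℤ, (b : ZMod p) ≠ 0 ∧ x = a / b ∧ z = a / b

namespace ReducesTo

variable {p : ℕ} [Fact p.Prime] {x y : ℚ} {z w : ZMod p}

theorem rat_ne_zero {b : ℤ} (hb : (b : ZMod p) ≠ 0) : (b : ℚ) ≠ 0 := by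
  rintro h
  apply hb
  have : b = 0 := by exact_mod_cast h
  simp [this]

theorem natCast (m : ℕ) : ReducesTo p (m : ℚ) (m : ZMod p) :=
  ⟨m, 1, by simp, by simp, by simp⟩

theorem add (hx : ReducesTo p x z) (hy : ReducesTo p y w) : ReducesTo p (x + y) (z + w) := by
  obtain ⟨a, b, hb, rfl, rfl⟩ := hx
  obtain ⟨c, d, hd, rfl, rfl⟩ := hy
  have hb' := rat_ne_zero hb
  have hd' := rat_ne_zero hd
  refine ⟨a * d + b * c, b * d, by push_cast; exact mul_ne_zero hb hd, ?_, ?_⟩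
  · push_cast; rw [div_add_div _ _ hb' hd']
  · push_cast; rw [div_add_div _ _ hb hd]

theorem mul (hx : ReducesTo p x z) (hy : ReducesTo p y w) : ReducesTo p (x * y) (z * w) := by
  obtain ⟨a, b, hb, rfl, rfl⟩ := hx
  obtain ⟨c, d, hd, rfl, rfl⟩ := hy
  refine ⟨a * c, b * d, by push_cast; exact mul_ne_zero hb hd, ?_, ?_⟩
  · push_cast; rw [div_mul_div_comm]
  · push_cast; rw [div_mul_div_comm]

theorem pow (hx : ReducesTo p x z) (m : ℕ) : ReducesTo p (x ^ m) (z ^ m) := by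
  induction m with
  | zero => simpa using natCast (p := p) 1
  | succ m ih => simpa only [pow_succ] using ih.mul hx

theorem natCast_inv {m : ℕ} (hm : (m : ZMod p) ≠ 0) :
    ReducesTo p ((m : ℚ)⁻¹) ((m : ZMod p)⁻¹) :=
  ⟨1, m, by simpa using hm, by simp, by simp⟩

theorem sum {f : ℕ → ℚ} {g : ℕ → ZMod p} (m : ℕ)
    (h : ∀ k < m, ReducesTo p (f k) (g k)) :
    ReducesTo p (∑ k ∈ Finset.range m, f k) (∑ k ∈ Finset.range m, g k) := by
  induction m with
  | zero => simpa using natCast (p := p) 0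
  | succ m ih =>
    rw [Finset.sum_range_succ, Finset.sum_range_succ]
    exact (ih fun k hk => h k (hk.trans m.lt_succ_self)).add (h m m.lt_succ_self)

theorem exists_eq_of_zero (hx : ReducesTo p x 0) :
    ∃ a b : ℤ, ¬ ((p : ℤ) ∣ b) ∧ x = (p : ℚ) * a / b := by
  obtain ⟨a, b, hb, rfl, h⟩ := hx
  have ha : (a : ZMod p) = 0 := by
    rcases div_eq_zero_iff.1 h.symm with h | h
    · exact h
    · exact absurd h hb
  obtain ⟨c, rfl⟩ := (ZMod.intCast_zmod_eq_zero_iff_dvd a p).1 ha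
  exact ⟨c, b, fun h => hb ((ZMod.intCast_zmod_eq_zero_iff_dvd b p).2 h), by push_cast; rfl⟩

end ReducesTo

section FiniteField

variable {p : ℕ} [Fact p.Prime]

theorem ZMod.natCast_succ_ne_zero {j : ℕ} (hj : j + 1 < p) : ((j : ZMod p) + 1) ≠ 0 := by
  intro h
  have h' : ((j + 1 : ℕ) : ZMod p) = 0 := by exact_mod_cast h
  rw [ZMod.natCast_eq_zero_iff] at h'
  exact absurd (Nat.le_of_dvd (by omega) h') (by omega)

theorem ZMod.sum_range_natCast (g : ZMod p → ZMod p) :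
    ∑ k ∈ Finset.range p, g k = ∑ x : ZMod p, g x := by
  refine Finset.sum_bij' (fun k _ => (k : ZMod p)) (fun x _ => x.val) ?_ ?_ ?_ ?_ ?_
  · intros; simp
  · intro x _; simpa using ZMod.val_lt x
  · intro k hk; exact ZMod.val_cast_of_lt (Finset.mem_range.1 hk)
  · intro x _; simp
  · intros; rfl

theorem ZMod.sum_eval_eq_zero (f : Polynomial (ZMod p)) (hf : f.natDegree < p - 1) :
    ∑ x : ZMod p, f.eval x = 0 := by
  simp_rw [Polynomial.eval_eq_sum_range]
  rw [Finset.sum_comm]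
  refine Finset.sum_eq_zero fun i hi => ?_
  rw [← Finset.mul_sum, FiniteField.sum_pow_lt_card_sub_one, mul_zero]
  rw [ZMod.card]
  have := Finset.mem_range.1 hi
  omega

/-- The second order harmonic numbers with values in `ZMod p`. -/
def harmZMod (p : ℕ) [Fact p.Prime] (m : ℕ) : ZMod p :=
  ∑ j ∈ Finset.range m, (((j : ZMod p) + 1) ^ 2)⁻¹

theorem harmZMod_pred (hp : 3 < p) : harmZMod p (p - 1) = 0 := by
  have h1 : ∑ k ∈ Finset.range p, ((k : ZMod p) ^ 2)⁻¹ = 0 := by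
    rw [ZMod.sum_range_natCast fun x => (x ^ 2)⁻¹]
    rw [← ZMod.sum_eval_eq_zero (p := p) (Polynomial.X ^ (p - 3))
      (by rw [Polynomial.natDegree_X_pow]; omega)]
    refine Finset.sum_congr rfl fun x _ => ?_
    rw [Polynomial.eval_pow, Polynomial.eval_X]
    rcases eq_or_ne x 0 with rfl | hx
    · rw [zero_pow two_ne_zero, inv_zero, zero_pow (by omega)]
    · rw [eq_comm]
      refine eq_inv_of_mul_eq_one_left ?_
      rw [← pow_add, ← ZMod.pow_card_sub_one_eq_one hx]
      congr 1
      omega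
  obtain ⟨m, rfl⟩ : ∃ m, p = m + 1 := ⟨p - 1, by omega⟩
  rw [Finset.sum_range_succ'] at h1
  simpa [harmZMod] using h1

theorem harmZMod_reflect (hp : 3 < p) {m : ℕ} (hm : m ≤ p - 1) :
    harmZMod p (p - 1 - m) = -harmZMod p m := by
  rw [eq_neg_iff_add_eq_zero, ← harmZMod_pred hp]
  conv_rhs => rw [← Nat.sub_add_cancel hm]
  rw [harmZMod, harmZMod, harmZMod, Finset.sum_range_add]
  congr 1
  rw [← Finset.sum_range_reflect]
  refine Finset.sum_congr rfl fun j hj => ?_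
  have hj := Finset.mem_range.1 hj
  have h : ((m - 1 - j : ℕ) : ZMod p) + 1 + (((p - 1 - m + j : ℕ) : ZMod p) + 1) = 0 := by
    rw [← ZMod.natCast_self p]
    norm_cast
    congr 1
    omega
  rw [eq_neg_of_add_eq_zero_left h, neg_sq]

theorem harmZMod_add (k d : ℕ) : harmZMod p (k + d) =
    harmZMod p k + ∑ i ∈ Finset.range d, (((k : ZMod p) + (i + 1)) ^ 2)⁻¹ := by
  rw [harmZMod, Finset.sum_range_add]
  simp [harmZMod, add_assoc]

/-- The product `(x + 1) ⋯ (x + d)` in `ZMod p`. -/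
def shiftProd (d : ℕ) (x : ZMod p) : ZMod p := ∏ i ∈ Finset.range d, (x + (i + 1))

theorem shiftProd_reflect {d k : ℕ} (hk : k + d + 1 ≤ p) :
    shiftProd d ((p - d - 1 - k : ℕ) : ZMod p) = (-1) ^ d * shiftProd d (k : ZMod p) := by
  rw [shiftProd, shiftProd, ← Finset.prod_range_reflect]
  conv_rhs => rw [← Finset.card_range d, ← Finset.prod_const, Finset.card_range,
    ← Finset.prod_mul_distrib]
  refine Finset.prod_congr rfl fun i hi => ?_
  have hi := Finset.mem_range.1 hi
  have h : ((p - d - 1 - k : ℕ) : ZMod p) + ((d - 1 - i : ℕ) + 1) + (k + (i + 1)) = 0 := by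
    rw [← ZMod.natCast_self p]
    norm_cast
    congr 1
    omega
  rw [eq_neg_of_add_eq_zero_left h, neg_one_mul]

theorem sum_shiftProd_pow_mul_inv_sq {n d i : ℕ} (hn : 2 < n) (hd : d * n + 1 < p) (hi : i < d) :
    ∑ k ∈ Finset.range (p - d),
      shiftProd d (k : ZMod p) ^ n * (((k : ZMod p) + (i + 1)) ^ 2)⁻¹ = 0 := by
  have hdp : d ≤ p := by nlinarith
  have hsub : Finset.range (p - d) ⊆ Finset.range p := Finset.range_mono (Nat.sub_le _ _)
  rw [Finset.sum_subset hsub, ZMod.sum_range_natCast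
    fun x => shiftProd d x ^ n * ((x + ((i : ZMod p) + 1)) ^ 2)⁻¹]
  · let L : ℕ → Polynomial (ZMod p) := fun j => Polynomial.X + Polynomial.C ((j : ZMod p) + 1)
    have hL : ∀ j, (L j).natDegree = 1 := fun j => Polynomial.natDegree_X_add_C _
    have hdeg : ((∏ j ∈ (Finset.range d).erase i, L j) ^ n * L i ^ (n - 2)).natDegree
        < p - 1 := by
      have h1 : (∏ j ∈ (Finset.range d).erase i, L j).natDegree ≤ d - 1 := by
        refine (Polynomial.natDegree_prod_le _ _).trans ?_
        simp [hL, Finset.card_erase_of_mem, Finset.mem_range.2 hi]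
      have h2 := Polynomial.natDegree_pow_le_of_le n h1
      have h3 := Polynomial.natDegree_pow_le_of_le (n - 2) (hL i).le
      have h4 := Polynomial.natDegree_mul_le_of_le h2 h3
      obtain ⟨e, rfl⟩ : ∃ e, d = e + 1 := ⟨d - 1, by omega⟩
      rw [Nat.add_sub_cancel] at h4
      refine h4.trans_lt ?_
      have : (e + 1) * n = n * e + n := by ring
      omega
    rw [← ZMod.sum_eval_eq_zero _ hdeg]
    refine Finset.sum_congr rfl fun x _ => ?_
    rw [shiftProd, ← Finset.prod_erase_mul _ _ (Finset.mem_range.2 hi)]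
    simp only [L, Polynomial.eval_mul, Polynomial.eval_pow, Polynomial.eval_prod,
      Polynomial.eval_add, Polynomial.eval_X, Polynomial.eval_C]
    rw [mul_pow, mul_assoc]
    congr 1
    rcases eq_or_ne (x + ((i : ZMod p) + 1)) 0 with h | h
    · rw [h, zero_pow (show n ≠ 0 by omega), zero_pow (show n - 2 ≠ 0 by omega), zero_mul]
    · rw [mul_inv_eq_iff_eq_mul₀ (pow_ne_zero _ h), ← pow_add]
      congr 1
      omega
  · intro k hk hk'
    have hk := Finset.mem_range.1 hk
    have hk' : p - d ≤ k := by simpa using hk'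
    have : shiftProd d (k : ZMod p) = 0 := by
      refine Finset.prod_eq_zero (i := p - 1 - k) (Finset.mem_range.2 (by omega)) ?_
      rw [← ZMod.natCast_self p]
      norm_cast
      congr 1
      omega
    rw [this, zero_pow (by omega), zero_mul]

theorem sum_shiftProd_pow_mul_harmZMod {n d : ℕ} (hn : 2 < n) (hpar : Even n ∨ Even d)
    (hp : 3 < p) (hd : d * n + 1 < p) :
    ∑ k ∈ Finset.range (p - d), shiftProd d (k : ZMod p) ^ n * harmZMod p k = 0 := by
  have hdp : d < p := by nlinarith
  set S := ∑ k ∈ Finset.range (p - d), shiftProd d (k : ZMod p) ^ n * harmZMod p k with hS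
  have hsign : ((-1 : ZMod p) ^ d) ^ n = 1 := by
    rw [← pow_mul]
    exact Even.neg_one_pow (hpar.elim (fun h => h.mul_left d) fun h => h.mul_right n)
  have hrefl : S = -∑ k ∈ Finset.range (p - d),
      shiftProd d (k : ZMod p) ^ n * harmZMod p (k + d) := by
    rw [hS, ← Finset.sum_range_reflect, ← Finset.sum_neg_distrib]
    refine Finset.sum_congr rfl fun k hk => ?_
    have hk := Finset.mem_range.1 hk
    rw [shiftProd_reflect (by omega), mul_pow, hsign, one_mul,
      show p - d - 1 - k = p - 1 - (k + d) by omega, harmZMod_reflect hp (by omega), mul_neg]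
  have hsum : ∑ k ∈ Finset.range (p - d), shiftProd d (k : ZMod p) ^ n * harmZMod p (k + d)
      = S := by
    simp_rw [harmZMod_add, mul_add, Finset.sum_add_distrib, Finset.mul_sum]
    rw [Finset.sum_comm, Finset.sum_eq_zero (fun i hi =>
      sum_shiftProd_pow_mul_inv_sq hn hd (Finset.mem_range.1 hi)), add_zero]
  rw [hsum] at hrefl
  have h2 : (2 : ZMod p) ≠ 0 := by
    have := ZMod.natCast_succ_ne_zero (p := p) (j := 1) (by omega)
    rwa [Nat.cast_one, one_add_one_eq_two] at this
  have : 2 * S = 0 := by linear_combination hrefl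
  exact (mul_eq_zero.1 this).resolve_left h2

theorem shiftProd_natCast (d k : ℕ) :
    shiftProd d (k : ZMod p) = ((d.factorial * (d + k).choose k : ℕ) : ZMod p) := by
  have h : d.factorial * (d + k).choose k = ∏ i ∈ Finset.range d, (k + (i + 1)) := by
    rw [← Nat.choose_symm_add, add_comm d k, ← Nat.ascFactorial_eq_factorial_mul_choose,
      Nat.ascFactorial_eq_prod_range]
    exact Finset.prod_congr rfl fun i _ => by ring
  rw [h, shiftProd]
  push_cast
  rfl

end FiniteField

theorem ascPochhammer_eval_div (d k : ℕ) :
    (ascPochhammer ℚ k).eval ((d + 1 : ℕ) : ℚ) / (ascPochhammer ℚ k).eval 1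
      = ((d + k).choose k : ℕ) := by
  rw [ascPochhammer_eval_one, ← ascPochhammer_eval_cast, ascPochhammer_nat_eq_ascFactorial,
    Nat.ascFactorial_eq_factorial_mul_choose, Nat.cast_mul,
    mul_div_cancel_left₀ _ (by exact_mod_cast k.factorial_ne_zero)]

theorem reducesTo_harm_two {p : ℕ} [Fact p.Prime] {k : ℕ} (hk : k < p) :
    ReducesTo p (harm 2 k) (harmZMod p k) := by
  refine ReducesTo.sum k fun j hj => ?_
  have h := (ReducesTo.natCast_inv (p := p) (m := j + 1)
    (by push_cast; exact ZMod.natCast_succ_ne_zero (by omega))).pow 2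
  simpa using h

/-- For integers `n > 2` and `q > 0` with `n` even or `q` odd, and any prime
`p > max {n, (q-1)n+1}`, the rational number `∑_{k=0}^{p-q} ((q)_k^n / (1)_k^n) H_k^{(2)}`
is congruent to `0` modulo `p`, i.e. it can be written as `p * a / b` with `p ∤ b`. -/
theorem stmt_8 (n q : ℕ) (hn : 2 < n) (hq : 0 < q) (hpar : Even n ∨ Odd q)
    (p : ℕ) (hp : p.Prime) (hgt : p > max n ((q - 1) * n + 1)) :
    ∃ a b : ℤ, ¬ ((p : ℤ) ∣ b) ∧
      ∑ k ∈ Finset.range (p - q + 1),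
          (((ascPochhammer ℚ k).eval (q : ℚ)) ^ n / ((ascPochhammer ℚ k).eval 1) ^ n) *
            harm 2 k
        = (p : ℚ) * a / b := by
  have : Fact p.Prime := ⟨hp⟩
  obtain ⟨d, rfl⟩ : ∃ d, q = d + 1 := ⟨q - 1, by omega⟩
  obtain ⟨hpn, hd⟩ := max_lt_iff.1 hgt
  rw [Nat.add_sub_cancel] at hd
  have hdp : d < p := by nlinarith
  have hpar' : Even n ∨ Even d :=
    hpar.imp_right fun h => by simpa [Nat.odd_add_one] using h
  rw [show p - (d + 1) + 1 = p - d by omega]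
  apply ReducesTo.exists_eq_of_zero
  have hS := sum_shiftProd_pow_mul_harmZMod (p := p) hn hpar' (by omega) hd
  have hfact : (d.factorial : ZMod p) ≠ 0 := by
    rw [Ne, ZMod.natCast_eq_zero_iff, hp.dvd_factorial]
    omega
  have hzero : ∑ k ∈ Finset.range (p - d),
      (((d + k).choose k : ℕ) : ZMod p) ^ n * harmZMod p k = 0 := by
    simp_rw [shiftProd_natCast, Nat.cast_mul, mul_pow, mul_assoc, ← Finset.mul_sum] at hS
    exact (mul_eq_zero.1 hS).resolve_left (pow_ne_zero n hfact)
  rw [← hzero]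
  refine ReducesTo.sum _ fun k hk => ?_
  rw [← div_pow, ascPochhammer_eval_div]
  exact ((ReducesTo.natCast _).pow n).mul (reducesTo_harm_two (by omega))
end

section
/- Let n > 2 and q > 0 be integers such that n is even or q is odd, and let p be a prime with p > max{n, (q-1)n + 1}. Then the rational number ∑_{k=0}^{p-q} ((q)_k^n / (1)_k^n) · (H_k^{(1)} - H_{q+k-1}^{(1)}) is congruent to 0 modulo p, i.e., its p-adic valuation is at least 1. -/
open Polynomial in
/-- The polynomial `(X + 1)(X + 2)⋯(X + m)` with integer coefficients. -/
noncomputable def shiftedRising (m : ℕ) : ℤ[X] :=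
  ∏ j ∈ Finset.range m, (X + C ((j : ℤ) + 1))

open Polynomial in
theorem natDegree_shiftedRising_le (m : ℕ) : (shiftedRising m).natDegree ≤ m := by
  refine (natDegree_prod_le _ _).trans ?_
  simp only [natDegree_X_add_C, Finset.sum_const, Finset.card_range, smul_eq_mul, mul_one, le_refl]

open Polynomial in
theorem eval_shiftedRising_mul_factorial (m k : ℕ) :
    (shiftedRising m).eval (k : ℤ) * k.factorial = (k + m).factorial := by
  induction m with
  | zero => simp [shiftedRising]
  | succ m ih =>
    rw [shiftedRising] at ih ⊢
    rw [Finset.prod_range_succ, eval_mul, mul_right_comm, ih, ← add_assoc, Nat.factorial_succ]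
    simp only [eval_add, eval_X, eval_C]
    push_cast
    ring

open Polynomial in
theorem eval_derivative_shiftedRising (m k : ℕ) :
    (((derivative (shiftedRising m)).eval (k : ℤ) : ℤ) : ℚ) =
      ((shiftedRising m).eval (k : ℤ) : ℤ) * (harm 1 (k + m) - harm 1 k) := by
  induction m with
  | zero => simp [shiftedRising]
  | succ m ih =>
    have hs : shiftedRising (m + 1) = shiftedRising m * (X + C ((m : ℤ) + 1)) :=
      Finset.prod_range_succ _ _
    have hh : harm 1 (k + (m + 1)) = harm 1 (k + m) + 1 / ((k : ℚ) + m + 1) := by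
      simp [harm, ← add_assoc, Finset.sum_range_succ]
    have h0 : (k : ℚ) + m + 1 ≠ 0 := by positivity
    rw [hs, hh]
    simp only [derivative_mul, eval_add, eval_mul, eval_X, eval_C, derivative_add, derivative_X,
      derivative_C, eval_one, eval_zero]
    push_cast
    rw [ih]
    field_simp
    ring

theorem ascPochhammer_div_ascPochhammer_one (m k : ℕ) :
    (ascPochhammer ℚ k).eval ((m + 1 : ℕ) : ℚ) / (ascPochhammer ℚ k).eval 1 =
      ((shiftedRising m).eval (k : ℤ) : ℤ) / (m.factorial : ℚ) := by
  have h1 : (ascPochhammer ℚ k).eval 1 = k.factorial := by simp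
  have h2 : (m.factorial : ℚ) * (ascPochhammer ℚ k).eval ((m + 1 : ℕ) : ℚ) =
      (k + m).factorial := by
    rw [← ascPochhammer_eval_cast, ascPochhammer_nat_eq_ascFactorial, add_comm k m,
      ← Nat.factorial_mul_ascFactorial]
    push_cast
    rfl
  have h3 : (((shiftedRising m).eval (k : ℤ) : ℤ) : ℚ) * k.factorial = (k + m).factorial := by
    exact_mod_cast eval_shiftedRising_mul_factorial m k
  rw [h1, div_eq_div_iff (by positivity) (by positivity), h3, ← h2, mul_comm]

open Polynomial in
/-- A polynomial of degree less than `p - 1` sums to zero over a full residue system mod `p`. -/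
theorem dvd_sum_range_eval {p : ℕ} (hp : p.Prime) (f : ℤ[X]) (hf : f.natDegree < p - 1) :
    (p : ℤ) ∣ ∑ k ∈ Finset.range p, f.eval (k : ℤ) := by
  have : Fact p.Prime := ⟨hp⟩
  have hcongr : ∀ i < p - 1, (p : ℤ) ∣ ∑ k ∈ Finset.range p, (k : ℤ) ^ i := by
    intro i hi
    rw [← ZMod.intCast_zmod_eq_zero_iff_dvd]
    push_cast
    rw [← FiniteField.sum_pow_lt_card_sub_one (ZMod p) i (by rwa [ZMod.card])]
    refine Finset.sum_bij (fun k _ => (k : ZMod p)) (fun _ _ => Finset.mem_univ _) ?_ ?_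
      (fun _ _ => rfl)
    · intro a ha b hb hab
      rw [ZMod.natCast_eq_natCast_iff] at hab
      exact hab.eq_of_lt_of_lt (Finset.mem_range.mp ha) (Finset.mem_range.mp hb)
    · intro b _
      exact ⟨b.val, Finset.mem_range.mpr b.val_lt, ZMod.natCast_zmod_val b⟩
  simp_rw [eval_eq_sum_range]
  rw [Finset.sum_comm]
  refine Finset.dvd_sum fun i hi => ?_
  rw [← Finset.mul_sum]
  exact (hcongr i (by have := Finset.mem_range.mp hi; omega)).mul_left _

theorem dvd_eval_shiftedRising {p m k : ℕ} (h1 : p ≤ k + m) (h2 : k < p) :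
    (p : ℤ) ∣ (shiftedRising m).eval (k : ℤ) := by
  rw [shiftedRising, Polynomial.eval_prod]
  have hmem : p - 1 - k ∈ Finset.range m := Finset.mem_range.mpr (by omega)
  refine dvd_trans ?_ (Finset.dvd_prod_of_mem _ hmem)
  simp only [Polynomial.eval_add, Polynomial.eval_X, Polynomial.eval_C]
  exact dvd_of_eq (by omega)

open Polynomial in
theorem dvd_sum_shiftedRising_pow_mul_derivative {p n m : ℕ} (hp : p.Prime) (hn : 0 < n)
    (h : m * (n + 1) + 1 < p) :
    (p : ℤ) ∣ ∑ k ∈ Finset.range (p - m),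
      ((shiftedRising m).eval (k : ℤ)) ^ n * (derivative (shiftedRising m)).eval (k : ℤ) := by
  have hdeg : (shiftedRising m ^ n * derivative (shiftedRising m)).natDegree < p - 1 := by
    have h1 := natDegree_shiftedRising_le m
    have h2 : (shiftedRising m ^ n).natDegree ≤ n * m := natDegree_pow_le_of_le n h1
    have h3 := natDegree_derivative_le (shiftedRising m)
    have h4 := natDegree_mul_le (p := shiftedRising m ^ n) (q := derivative (shiftedRising m))
    have h5 : m * (n + 1) = n * m + m := by ring
    omega
  have hsum := dvd_sum_range_eval hp _ hdeg
  simp only [eval_mul, eval_pow] at hsum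
  rw [← Finset.sum_range_add_sum_Ico _ (Nat.sub_le p m)] at hsum
  refine (dvd_add_left (Finset.dvd_sum fun k hk => ?_)).mp hsum
  rw [Finset.mem_Ico] at hk
  exact ((dvd_eval_shiftedRising (by omega) hk.2).trans (dvd_pow_self _ hn.ne')).mul_right _

/-- For integers `n > 2` and `q > 0` with `n` even or `q` odd, and any prime
`p > max {n, (q-1)n+1}`, the rational number
`∑_{k=0}^{p-q} ((q)_k^n / (1)_k^n) (H_k^{(1)} - H_{q+k-1}^{(1)})`
is congruent to `0` modulo `p`, i.e. it can be written as `p * a / b` with `p ∤ b`. -/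
theorem stmt_10 (n q : ℕ) (hn : 2 < n) (hq : 0 < q) (hpar : Even n ∨ Odd q)
    (p : ℕ) (hp : p.Prime) (hgt : p > max n ((q - 1) * n + 1)) :
    ∃ a b : ℤ, ¬ ((p : ℤ) ∣ b) ∧
      ∑ k ∈ Finset.range (p - q + 1),
          (((ascPochhammer ℚ k).eval (q : ℚ)) ^ n / ((ascPochhammer ℚ k).eval 1) ^ n) *
            (harm 1 k - harm 1 (q + k - 1))
        = (p : ℚ) * a / b := by
  obtain ⟨m, rfl⟩ : ∃ m, q = m + 1 := ⟨q - 1, by omega⟩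
  obtain ⟨r, rfl⟩ : ∃ r, n = r + 1 := ⟨n - 1, by omega⟩
  have hlt : m * (r + 1) + 1 < p := (le_max_right _ _).trans_lt hgt
  have hmp : m < p := by nlinarith
  obtain ⟨a, ha⟩ := dvd_sum_shiftedRising_pow_mul_derivative hp (by omega : 0 < r) hlt
  refine ⟨-a, (m.factorial : ℤ) ^ (r + 1), ?_, ?_⟩
  · intro hdvd
    have h := (Nat.prime_iff_prime_int.mp hp).dvd_of_dvd_pow hdvd
    exact absurd (hp.dvd_factorial.mp (Int.natCast_dvd_natCast.mp h)) (by omega)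
  · have hterm : ∀ k : ℕ,
        (((ascPochhammer ℚ k).eval ((m + 1 : ℕ) : ℚ)) ^ (r + 1) /
            ((ascPochhammer ℚ k).eval 1) ^ (r + 1)) * (harm 1 k - harm 1 (m + 1 + k - 1)) =
          -((((shiftedRising m).eval (k : ℤ) ^ r *
            (Polynomial.derivative (shiftedRising m)).eval (k : ℤ) : ℤ) : ℚ)) /
              (m.factorial : ℚ) ^ (r + 1) := by
      intro k
      rw [← div_pow, ascPochhammer_div_ascPochhammer_one, show m + 1 + k - 1 = k + m by omega]
      push_cast
      rw [eval_derivative_shiftedRising]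
      ring
    rw [Finset.sum_congr rfl fun k _ => hterm k, ← Finset.sum_div, Finset.sum_neg_distrib,
      ← Int.cast_sum, show p - (m + 1) + 1 = p - m by omega, ha]
    push_cast
    ring
end
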